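/- arXiv:1711.11208 — 2 statements merged into one kernel-verified Lean document; each statement's English description precedes it below -/
import Mathlib

section
/- Let A = (Q, Σ, →) be a labeled transition system and p₀, q₀ ∈ Q be infinitary ready trace equivalent processes (i.e., RT(p₀) = RT(q₀) and RT^∞(p₀) = RT^∞(q₀)). Then for every subset F ⊆ Σ, the strong fair languages of p₀ and q₀ with respect to F are equal: L^Φ_F(p₀) = L^Φ_F(q₀). -/
/-- A labeled transition system over states `Q` and alphabet `σ`. -/
structure LTS (Q σ : Type) where
  tr : Q → σ → Q → Prop

namespace LTS

variable {Q σ : Type}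

/-- Action `a` is enabled in process `p`. -/
def Enabled (A : LTS Q σ) (p : Q) (a : σ) : Prop := ∃ p', A.tr p a p'

/-- `FinRun A p l q` : there is a finite run from `p` to `q` with trace `l`. -/
inductive FinRun (A : LTS Q σ) : Q → List σ → Q → Prop
  | nil (p : Q) : FinRun A p [] p
  | cons {p p' q : Q} {a : σ} {l : List σ} :
      A.tr p a p' → FinRun A p' l q → FinRun A p (a :: l) q

/-- Traces of finite runs of `p`. -/
def FinTraces (A : LTS Q σ) (p : Q) : Set (List σ) := {l | ∃ q, A.FinRun p l q}

/-- An infinite run of `p` with state sequence `s` and label sequence `w`. -/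
def InfRun (A : LTS Q σ) (p : Q) (s : ℕ → Q) (w : ℕ → σ) : Prop :=
  s 0 = p ∧ ∀ i, A.tr (s i) (w i) (s (i + 1))

/-- Traces of infinite runs of `p`. -/
def InfTraces (A : LTS Q σ) (p : Q) : Set (ℕ → σ) := {w | ∃ s, A.InfRun p s w}

/-- An infinite run (given by states `s` and labels `w`) is strong fair w.r.t. `F`:
for every `a ∈ F`, if `a` is enabled in infinitely many states then `a` occurs
infinitely often among the labels. -/
def StrongFair (A : LTS Q σ) (F : Set σ) (s : ℕ → Q) (w : ℕ → σ) : Prop :=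
  ∀ a ∈ F, (∀ i, ∃ j, i ≤ j ∧ A.Enabled (s j) a) → (∀ i, ∃ j, i ≤ j ∧ w j = a)

/-- An infinite run is weak fair w.r.t. `F`: for every `a ∈ F`, if from some point
on `a` is always enabled, then `a` occurs infinitely often among the labels. -/
def WeakFair (A : LTS Q σ) (F : Set σ) (s : ℕ → Q) (w : ℕ → σ) : Prop :=
  ∀ a ∈ F, (∃ i, ∀ j, i ≤ j → A.Enabled (s j) a) → (∀ i, ∃ j, i ≤ j ∧ w j = a)

/-- The strong fair language of `p` w.r.t. `F`: all traces of finite runs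
(finite runs are always fair) together with all traces of strong fair infinite runs. -/
def SFairLang (A : LTS Q σ) (F : Set σ) (p : Q) : Set (List σ ⊕ (ℕ → σ)) :=
  fun x => Sum.elim (fun l => l ∈ A.FinTraces p)
    (fun w => ∃ s, A.InfRun p s w ∧ A.StrongFair F s w) x

/-- The weak fair language of `p` w.r.t. `F`: all traces of finite runs
(finite runs are always fair) together with all traces of weak fair infinite runs. -/
def WFairLang (A : LTS Q σ) (F : Set σ) (p : Q) : Set (List σ ⊕ (ℕ → σ)) :=
  fun x => Sum.elim (fun l => l ∈ A.FinTraces p)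
    (fun w => ∃ s, A.InfRun p s w ∧ A.WeakFair F s w) x

end LTS

namespace LTS

variable {Q σ : Type}

/-- `RTraceFrom A p l` : `l` is a finite ready trace of `p`, a word over `σ ⊕ Set σ`
where letters are transitions taken and sets are the ready sets (the sets of exactly
the enabled actions) of the current process. -/
inductive RTraceFrom (A : LTS Q σ) : Q → List (σ ⊕ Set σ) → Prop
  | nil (p : Q) : RTraceFrom A p []
  | act {p p' : Q} {a : σ} {l : List (σ ⊕ Set σ)} :
      A.tr p a p' → RTraceFrom A p' l → RTraceFrom A p (Sum.inl a :: l)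
  | ready {p : Q} {X : Set σ} {l : List (σ ⊕ Set σ)} :
      X = {a | A.Enabled p a} → RTraceFrom A p l → RTraceFrom A p (Sum.inr X :: l)

/-- The set of finite ready traces of `p`. -/
def RTraces (A : LTS Q σ) (p : Q) : Set (List (σ ⊕ Set σ)) := {l | A.RTraceFrom p l}

/-- The set of infinite ready traces of `p`. -/
def InfRTraces (A : LTS Q σ) (p : Q) : Set (ℕ → σ ⊕ Set σ) :=
  {w | ∃ s : ℕ → Q, s 0 = p ∧ ∀ i,
    (∃ a : σ, w i = Sum.inl a ∧ A.tr (s i) a (s (i + 1))) ∨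
    (∃ X : Set σ, w i = Sum.inr X ∧ s (i + 1) = s i ∧ X = {a | A.Enabled (s i) a})}

end LTS

namespace LTS

variable {Q σ : Type} {A : LTS Q σ} {p q : Q}

theorem FinRun.rTraceFrom {l : List σ} (h : A.FinRun p l q) :
    A.RTraceFrom p (l.map Sum.inl) := by
  induction h with
  | nil p => exact .nil p
  | cons htr _ ih => exact .act htr ih

theorem mem_finTraces_of_rTraceFrom {l : List σ} (h : A.RTraceFrom p (l.map Sum.inl)) :
    l ∈ A.FinTraces p := by
  induction l generalizing p with
  | nil => exact ⟨p, .nil p⟩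
  | cons a l ih =>
    cases h with
    | act htr h =>
      obtain ⟨r, hr⟩ := ih h
      exact ⟨r, .cons htr hr⟩

theorem mem_finTraces_iff {l : List σ} :
    l ∈ A.FinTraces p ↔ l.map Sum.inl ∈ A.RTraces p :=
  ⟨fun ⟨_, h⟩ => h.rTraceFrom, mem_finTraces_of_rTraceFrom⟩

/-- The infinite word alternating the sets `R i` with the actions `w i`. -/
def interleave (R : ℕ → Set σ) (w : ℕ → σ) (n : ℕ) : σ ⊕ Set σ :=
  if n % 2 = 0 then Sum.inr (R (n / 2)) else Sum.inl (w (n / 2))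

theorem interleave_two_mul (R : ℕ → Set σ) (w : ℕ → σ) (i : ℕ) :
    interleave R w (2 * i) = Sum.inr (R i) := by
  simp [interleave]

theorem interleave_two_mul_add_one (R : ℕ → Set σ) (w : ℕ → σ) (i : ℕ) :
    interleave R w (2 * i + 1) = Sum.inl (w i) := by
  have h : (2 * i + 1) / 2 = i := by omega
  simp [interleave, h]

theorem interleave_mem_infRTraces_iff {R : ℕ → Set σ} {w : ℕ → σ} :
    interleave R w ∈ A.InfRTraces p ↔
      ∃ s, A.InfRun p s w ∧ ∀ i, R i = {a | A.Enabled (s i) a} := by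
  constructor
  · rintro ⟨t, h0, ht⟩
    have hready (i : ℕ) : t (2 * i + 1) = t (2 * i) ∧ R i = {a | A.Enabled (t (2 * i)) a} := by
      rcases ht (2 * i) with ⟨a, ha, _⟩ | ⟨X, hX, hstay, hen⟩
      · simp [interleave_two_mul] at ha
      · rw [interleave_two_mul] at hX
        cases hX
        exact ⟨hstay, hen⟩
    refine ⟨fun i => t (2 * i), ⟨h0, fun i => ?_⟩, fun i => (hready i).2⟩
    rcases ht (2 * i + 1) with ⟨a, ha, htr⟩ | ⟨X, hX, _⟩
    · rw [interleave_two_mul_add_one] at ha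
      cases ha
      rwa [(hready i).1] at htr
    · simp [interleave_two_mul_add_one] at hX
  · rintro ⟨s, ⟨h0, hs⟩, hR⟩
    refine ⟨fun n => s (n / 2), by simpa using h0, fun n => ?_⟩
    rcases Nat.even_or_odd' n with ⟨i, rfl | rfl⟩
    · have h₁ : 2 * i / 2 = i := by omega
      have h₂ : (2 * i + 1) / 2 = i := by omega
      refine Or.inr ⟨R i, interleave_two_mul R w i, ?_, ?_⟩
      · simp only [h₁, h₂]
      · simpa only [h₁] using hR i
    · have h₁ : (2 * i + 1) / 2 = i := by omega
      have h₂ : (2 * i + 1 + 1) / 2 = i + 1 := by omega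
      refine Or.inl ⟨w i, interleave_two_mul_add_one R w i, ?_⟩
      simpa only [h₁, h₂] using hs i

theorem StrongFair.congr_enabled {F : Set σ} {s t : ℕ → Q} {w : ℕ → σ}
    (h : ∀ i a, A.Enabled (t i) a ↔ A.Enabled (s i) a) (hs : A.StrongFair F s w) :
    A.StrongFair F t w := by
  intro a ha hen
  refine hs a ha fun i => ?_
  obtain ⟨j, hij, hj⟩ := hen i
  exact ⟨j, hij, (h j a).1 hj⟩

theorem sFairLang_subset (hfin : A.RTraces p ⊆ A.RTraces q)
    (hinf : A.InfRTraces p ⊆ A.InfRTraces q) (F : Set σ) :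
    A.SFairLang F p ⊆ A.SFairLang F q := by
  rintro (l | w) hx
  · exact mem_finTraces_iff.2 (hfin (mem_finTraces_iff.1 hx))
  · obtain ⟨s, hrun, hfair⟩ := hx
    obtain ⟨t, ht, hen⟩ := interleave_mem_infRTraces_iff.1
      (hinf (interleave_mem_infRTraces_iff.2 ⟨s, hrun, fun _ => rfl⟩))
    exact ⟨t, ht, hfair.congr_enabled fun i a => (Set.ext_iff.1 (hen i) a).symm⟩

end LTS

/-- If `p₀` and `q₀` are infinitary ready trace equivalent
(equal finite and infinite ready traces), then for every `F ⊆ Σ` their strong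
fair languages w.r.t. `F` coincide. -/
theorem strongFairLang_eq_of_readyTraceEquiv {Q σ : Type} (A : LTS Q σ) (p₀ q₀ : Q)
    (hfin : A.RTraces p₀ = A.RTraces q₀)
    (hinf : A.InfRTraces p₀ = A.InfRTraces q₀) :
    ∀ F : Set σ, A.SFairLang F p₀ = A.SFairLang F q₀ := by
  exact fun F => (LTS.sFairLang_subset hfin.subset hinf.subset F).antisymm
    (LTS.sFairLang_subset hfin.superset hinf.superset F)
end

section
/- Let A = (Q, Σ, →) be a labeled transition system and p₀, q₀ ∈ Q be bisimilar processes. Then for every subset F ⊆ Σ, the strong fair languages of p₀ and q₀ with respect to F are equal: L^Φ_F(p₀) = L^Φ_F(q₀). -/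
namespace LTS

variable {Q σ : Type}

/-- `R` is a bisimulation on the LTS `A`. -/
def IsBisimulation (A : LTS Q σ) (R : Q → Q → Prop) : Prop :=
  ∀ p q, R p q →
    (∀ (a : σ) (p' : Q), A.tr p a p' → ∃ q', A.tr q a q' ∧ R p' q') ∧
    (∀ (a : σ) (q' : Q), A.tr q a q' → ∃ p', A.tr p a p' ∧ R p' q')

/-- `p` and `q` are bisimilar: some bisimulation relates them. -/
def Bisimilar (A : LTS Q σ) (p q : Q) : Prop :=
  ∃ R, A.IsBisimulation R ∧ R p q

end LTS

namespace LTS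

variable {Q σ : Type}

theorem IsBisimulation.swap {A : LTS Q σ} {R : Q → Q → Prop} (hR : A.IsBisimulation R) :
    A.IsBisimulation (fun p q => R q p) :=
  fun p q h => ⟨(hR q p h).2, (hR q p h).1⟩

theorem Bisimilar.symm {A : LTS Q σ} {p q : Q} (h : A.Bisimilar p q) : A.Bisimilar q p :=
  let ⟨_, hR, hpq⟩ := h
  ⟨_, hR.swap, hpq⟩

theorem IsBisimulation.enabled_iff {A : LTS Q σ} {R : Q → Q → Prop} (hR : A.IsBisimulation R)
    {p q : Q} (h : R p q) (a : σ) : A.Enabled p a ↔ A.Enabled q a :=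
  ⟨fun ⟨p', hp⟩ => let ⟨q', hq, _⟩ := (hR p q h).1 a p' hp; ⟨q', hq⟩,
    fun ⟨q', hq⟩ => let ⟨p', hp, _⟩ := (hR p q h).2 a q' hq; ⟨p', hp⟩⟩

theorem IsBisimulation.exists_finRun {A : LTS Q σ} {R : Q → Q → Prop} (hR : A.IsBisimulation R)
    {p p' q : Q} {l : List σ} (hrun : A.FinRun p l p') (h : R p q) :
    ∃ q', A.FinRun q l q' ∧ R p' q' := by
  induction hrun generalizing q with
  | nil p => exact ⟨q, .nil q, h⟩
  | cons htr _ ih =>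
    obtain ⟨q₁, hq₁, h₁⟩ := (hR _ _ h).1 _ _ htr
    obtain ⟨q', hq', h'⟩ := ih h₁
    exact ⟨q', .cons hq₁ hq', h'⟩

theorem IsBisimulation.exists_infRun {A : LTS Q σ} {R : Q → Q → Prop} (hR : A.IsBisimulation R)
    {p q : Q} {s : ℕ → Q} {w : ℕ → σ} (hrun : A.InfRun p s w) (h : R p q) :
    ∃ t, A.InfRun q t w ∧ ∀ i, R (s i) (t i) := by
  obtain ⟨rfl, hs⟩ := hrun
  have step (i : ℕ) (x : {q // R (s i) q}) :
      ∃ y : {q // R (s (i + 1)) q}, A.tr x.1 (w i) y.1 :=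
    let ⟨y, hy, hRy⟩ := (hR _ _ x.2).1 _ _ (hs i)
    ⟨⟨y, hRy⟩, hy⟩
  choose next hnext using step
  let t : (i : ℕ) → {q // R (s i) q} := fun i => Nat.rec ⟨q, h⟩ next i
  exact ⟨fun i => (t i).1, ⟨rfl, fun i => hnext i (t i)⟩, fun i => (t i).2⟩

theorem IsBisimulation.strongFair {A : LTS Q σ} {R : Q → Q → Prop} (hR : A.IsBisimulation R)
    {F : Set σ} {s t : ℕ → Q} {w : ℕ → σ} (hst : ∀ i, R (s i) (t i))
    (hs : A.StrongFair F s w) : A.StrongFair F t w :=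
  fun a ha hen => hs a ha fun i =>
    let ⟨j, hij, hj⟩ := hen i
    ⟨j, hij, (hR.enabled_iff (hst j) a).2 hj⟩

theorem Bisimilar.sFairLang_subset {A : LTS Q σ} {p q : Q} (h : A.Bisimilar p q) (F : Set σ) :
    A.SFairLang F p ⊆ A.SFairLang F q := by
  obtain ⟨R, hR, hpq⟩ := h
  rintro (l | w) hx
  · obtain ⟨p', hp'⟩ := hx
    obtain ⟨q', hq', _⟩ := hR.exists_finRun hp' hpq
    exact ⟨q', hq'⟩
  · obtain ⟨s, hs, hfair⟩ := hx
    obtain ⟨t, ht, hst⟩ := hR.exists_infRun hs hpq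
    exact ⟨t, ht, hR.strongFair hst hfair⟩

end LTS

/-- If `p₀` and `q₀` are bisimilar, then for every `F ⊆ Σ`
their strong fair languages w.r.t. `F` coincide. -/
theorem strongFairLang_eq_of_bisimilar {Q σ : Type} (A : LTS Q σ) (p₀ q₀ : Q)
    (h : A.Bisimilar p₀ q₀) :
    ∀ F : Set σ, A.SFairLang F p₀ = A.SFairLang F q₀ := by
  exact fun F => (h.sFairLang_subset F).antisymm (h.symm.sFairLang_subset F)
end
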